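/- For unit quaternions a, b, the map v ↦ a v (conj b) is an ℝ-linear isometry of ℍ; the assignment (a,b) ↦ (v ↦ a v (conj b)) is a group homomorphism from Sp(1) × Sp(1) (pairs of unit quaternions) to the group of ℝ-linear isometries of ℍ whose kernel is {(1,1), (−1,−1)} and whose image consists exactly of the ℝ-linear isometries of ℍ of determinant 1. -/

import Mathlib

open Quaternion

/-- The linear isometry `v ↦ a * v * star b` of `ℍ` attached to unit quaternions `a` and `b`. -/
noncomputable def unitaryMulMulStar (p : unitary ℍ × unitary ℍ) : ℍ ≃ₗᵢ[ℝ] ℍ where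
  toFun v := p.1 * v * star (p.2 : ℍ)
  invFun v := star (p.1 : ℍ) * v * p.2
  map_add' v w := by rw [mul_add, add_mul]
  map_smul' r v := by simp
  left_inv v := by
    calc star (p.1 : ℍ) * (p.1 * v * star (p.2 : ℍ)) * p.2
        = (star (p.1 : ℍ) * p.1) * v * (star (p.2 : ℍ) * p.2) := by simp only [mul_assoc]
      _ = v := by simp
  right_inv v := by
    calc p.1 * (star (p.1 : ℍ) * v * p.2) * star (p.2 : ℍ)
        = (p.1 * star (p.1 : ℍ)) * v * (p.2 * star (p.2 : ℍ)) := by simp only [mul_assoc]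
      _ = v := by simp
  norm_map' v := by
    change ‖(p.1 : ℍ) * v * star (p.2 : ℍ)‖ = ‖v‖
    rw [norm_mul, norm_mul, norm_star, CStarRing.norm_coe_unitary, CStarRing.norm_coe_unitary,
      one_mul, mul_one]

@[simp]
theorem unitaryMulMulStar_apply (p : unitary ℍ × unitary ℍ) (v : ℍ) :
    unitaryMulMulStar p v = p.1 * v * star (p.2 : ℍ) := rfl

/-- The homomorphism from pairs of unit quaternions to isometries of `ℍ`. -/
noncomputable def unitaryMulMulStarHom : (unitary ℍ × unitary ℍ) →* (ℍ ≃ₗᵢ[ℝ] ℍ) where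
  toFun := unitaryMulMulStar
  map_one' := by ext1 v; simp
  map_mul' p q := by ext1 v; simp [mul_assoc]

@[simp]
theorem unitaryMulMulStarHom_apply (p : unitary ℍ × unitary ℍ) (v : ℍ) :
    unitaryMulMulStarHom p v = p.1 * v * star (p.2 : ℍ) := rfl

theorem Quaternion.normSq_coe_unitary (a : unitary ℍ) : normSq (a : ℍ) = 1 := by
  rw [normSq_eq_norm_mul_self, CStarRing.norm_coe_unitary, one_mul]

/-- The basis `1, i, j, k` of `ℍ`. -/
noncomputable def Quaternion.basisOneIJK : Module.Basis (Fin 4) ℝ ℍ :=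
  .ofEquivFun
    { toFun q := ![q.re, q.imI, q.imJ, q.imK]
      invFun v := ⟨v 0, v 1, v 2, v 3⟩
      map_add' p q := by simp
      map_smul' r q := by simp
      left_inv q := rfl
      right_inv v := by ext i; fin_cases i <;> rfl }

@[simp]
theorem Quaternion.basisOneIJK_repr (q : ℍ) :
    (basisOneIJK.repr q : Fin 4 → ℝ) = ![q.re, q.imI, q.imJ, q.imK] := rfl

@[simp]
theorem Quaternion.re_basisOneIJK (i : Fin 4) : (basisOneIJK i).re = if i = 0 then 1 else 0 :=
  basisOneIJK.repr_self_apply i 0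

@[simp]
theorem Quaternion.imI_basisOneIJK (i : Fin 4) : (basisOneIJK i).imI = if i = 1 then 1 else 0 :=
  basisOneIJK.repr_self_apply i 1

@[simp]
theorem Quaternion.imJ_basisOneIJK (i : Fin 4) : (basisOneIJK i).imJ = if i = 2 then 1 else 0 :=
  basisOneIJK.repr_self_apply i 2

@[simp]
theorem Quaternion.imK_basisOneIJK (i : Fin 4) : (basisOneIJK i).imK = if i = 3 then 1 else 0 :=
  basisOneIJK.repr_self_apply i 3

theorem Quaternion.det_eq_matrix_det (f : ℍ →ₗ[ℝ] ℍ) :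
    LinearMap.det f = Matrix.det (Matrix.of fun i j =>
      ![(f (basisOneIJK j)).re, (f (basisOneIJK j)).imI, (f (basisOneIJK j)).imJ,
        (f (basisOneIJK j)).imK] i) := by
  rw [← LinearMap.det_toMatrix basisOneIJK]
  congr 1
  ext i j
  rw [LinearMap.toMatrix_apply, basisOneIJK_repr, Matrix.of_apply]

theorem Quaternion.det_mulLeft (a : ℍ) : LinearMap.det (LinearMap.mulLeft ℝ a) = normSq a ^ 2 := by
  rw [det_eq_matrix_det, normSq_def']
  simp [Matrix.det_succ_row_zero, Fin.sum_univ_succ, Fin.succAbove]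
  ring

theorem Quaternion.det_mulRight (a : ℍ) :
    LinearMap.det (LinearMap.mulRight ℝ a) = normSq a ^ 2 := by
  rw [det_eq_matrix_det, normSq_def']
  simp [Matrix.det_succ_row_zero, Fin.sum_univ_succ, Fin.succAbove]
  ring

/-- Quaternion conjugation as a real linear map. -/
def Quaternion.starLinearMap : ℍ →ₗ[ℝ] ℍ where
  toFun := star
  map_add' := star_add
  map_smul' := Quaternion.star_smul

@[simp]
theorem Quaternion.starLinearMap_apply (q : ℍ) : starLinearMap q = star q := rfl

theorem Quaternion.det_starLinearMap : LinearMap.det starLinearMap = -1 := by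
  rw [det_eq_matrix_det]
  simp [Matrix.det_succ_row_zero, Fin.sum_univ_succ, Fin.succAbove]

theorem det_unitaryMulMulStarHom (p : unitary ℍ × unitary ℍ) :
    LinearMap.det ((unitaryMulMulStarHom p).toLinearEquiv : ℍ →ₗ[ℝ] ℍ) = 1 := by
  have h : ((unitaryMulMulStarHom p).toLinearEquiv : ℍ →ₗ[ℝ] ℍ) =
      LinearMap.mulRight ℝ (star (p.2 : ℍ)) ∘ₗ LinearMap.mulLeft ℝ (p.1 : ℍ) := by
    ext1 v; rfl
  rw [h, LinearMap.det_comp, det_mulLeft, det_mulRight, normSq_star, normSq_coe_unitary,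
    normSq_coe_unitary]
  norm_num

theorem unitaryMulMulStarHom_eq_one_iff (p : unitary ℍ × unitary ℍ) :
    unitaryMulMulStarHom p = 1 ↔
      ((p.1 : ℍ) = 1 ∧ (p.2 : ℍ) = 1) ∨ ((p.1 : ℍ) = -1 ∧ (p.2 : ℍ) = -1) := by
  obtain ⟨a, b⟩ := p
  constructor
  · intro h
    have hv (v : ℍ) : (a : ℍ) * v = v * b := by
      have := congrArg (fun f : ℍ ≃ₗᵢ[ℝ] ℍ => f v * (b : ℍ)) h
      simpa [mul_assoc] using this
    have hab : (a : ℍ) = b := by simpa using hv 1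
    have hn := normSq_coe_unitary a
    have hi := hv (basisOneIJK 1)
    have hj := hv (basisOneIJK 2)
    change (a : ℍ) = 1 ∧ (b : ℍ) = 1 ∨ (a : ℍ) = -1 ∧ (b : ℍ) = -1
    rw [← hab] at hi hj ⊢
    generalize (a : ℍ) = q at *
    have hi3 := congrArg (fun x : ℍ => x.imJ) hi
    have hi4 := congrArg (fun x : ℍ => x.imK) hi
    have hj4 := congrArg (fun x : ℍ => x.imK) hj
    simp at hi3 hi4 hj4
    have h1 : q.imI = 0 := by linarith
    have h2 : q.imJ = 0 := by linarith
    have h3 : q.imK = 0 := by linarith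
    have h0 : q.re = 1 ∨ q.re = -1 := by
      rw [normSq_def', h1, h2, h3] at hn
      exact sq_eq_sq_iff_eq_or_eq_neg.1 (by linarith)
    refine h0.imp (fun h0 => ?_) (fun h0 => ?_) <;>
      exact and_self_iff.2 (by ext <;> simp [h0, h1, h2, h3])
  · rintro (⟨h1, h2⟩ | ⟨h1, h2⟩) <;> ext1 v <;> simp_all

theorem Quaternion.reflection_orthogonal_span_singleton (u : unitary ℍ) (x : ℍ) :
    (ℝ ∙ (u : ℍ))ᗮ.reflection x = -(u * star x * u) := by
  have hn := normSq_coe_unitary u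
  rw [Submodule.reflection_orthogonal_apply, Submodule.reflection_singleton_apply,
    CStarRing.norm_coe_unitary, inner_def]
  generalize (u : ℍ) = q at *
  rw [normSq_def'] at hn
  congr 1
  rw [two_smul]
  ext <;> simp
  · linear_combination x.re * hn
  · linear_combination x.imI * hn
  · linear_combination x.imJ * hn
  · linear_combination x.imK * hn

/-- A reflection in a hyperplane of `ℍ` is trivial or of the form `x ↦ a * star x * star b`. -/
theorem Quaternion.exists_reflection_eq (v : ℍ) :
    (ℝ ∙ v)ᗮ.reflection = 1 ∨
      ∃ p, ∀ x, (ℝ ∙ v)ᗮ.reflection x = unitaryMulMulStarHom p (star x) := by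
  rcases eq_or_ne v 0 with rfl | hv
  · left
    ext1 x
    exact Submodule.reflection_mem_subspace_eq_self (by simp)
  · right
    have hmem : ‖v‖⁻¹ • v ∈ unitary ℍ := by
      have h : normSq (‖v‖⁻¹ • v) = 1 := by
        rw [normSq_eq_norm_mul_self, norm_smul, norm_inv, norm_norm,
          inv_mul_cancel₀ (norm_ne_zero_iff.2 hv), one_mul]
      rw [Unitary.mem_iff, star_mul_self, self_mul_star, h]
      simp
    refine ⟨(-⟨_, hmem⟩, star ⟨_, hmem⟩), fun x => ?_⟩
    have hspan : (ℝ ∙ v) = ℝ ∙ (‖v‖⁻¹ • v) :=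
      (Submodule.span_singleton_smul_eq
        (IsUnit.mk0 _ (inv_ne_zero (norm_ne_zero_iff.2 hv))) v).symm
    have h := reflection_orthogonal_span_singleton ⟨_, hmem⟩ x
    simp only [hspan]
    rw [h]
    simp [Unitary.coe_neg]

theorem star_unitaryMulMulStarHom (p : unitary ℍ × unitary ℍ) (x : ℍ) :
    star (unitaryMulMulStarHom p x) = unitaryMulMulStarHom p.swap (star x) := by
  simp [mul_assoc]

/-- Every linear isometry of `ℍ` is `x ↦ a * x * star b` or `x ↦ a * star x * star b`. -/
theorem Quaternion.linearIsometryEquiv_eq (f : ℍ ≃ₗᵢ[ℝ] ℍ) :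
    (∃ p, ∀ x, f x = unitaryMulMulStarHom p x) ∨
      ∃ p, ∀ x, f x = unitaryMulMulStarHom p (star x) := by
  obtain ⟨l, -, rfl⟩ := f.reflections_generate_dim
  induction l with
  | nil => exact .inl ⟨1, fun x => by simp⟩
  | cons v l ih =>
    simp only [List.map_cons, List.prod_cons, LinearIsometryEquiv.coe_mul, Function.comp_apply]
    rcases exists_reflection_eq v with hv | ⟨q, hv⟩
    · simpa only [hv, LinearIsometryEquiv.coe_one, id_eq] using ih
    · rcases ih with ⟨p, hp⟩ | ⟨p, hp⟩
      · refine .inr ⟨q * p.swap, fun x => ?_⟩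
        rw [hv, hp, star_unitaryMulMulStarHom, map_mul, LinearIsometryEquiv.coe_mul,
          Function.comp_apply]
      · refine .inl ⟨q * p.swap, fun x => ?_⟩
        rw [hv, hp, star_unitaryMulMulStarHom, star_star, map_mul, LinearIsometryEquiv.coe_mul,
          Function.comp_apply]

/-- For unit quaternions `a, b`, the map `v ↦ a v (conj b)` is a linear isometry of `ℍ`;
`(a, b) ↦ (v ↦ a v (conj b))` is a group homomorphism from `Sp(1) × Sp(1)` to the linear
isometries of `ℍ` with kernel `{(1,1), (-1,-1)}` and image exactly the isometries of
determinant `1`. -/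
theorem quaternion_sp1_sp1_to_so4 :
    ∃ Φ : (unitary ℍ × unitary ℍ) →* (ℍ ≃ₗᵢ[ℝ] ℍ),
      (∀ (a b : unitary ℍ) (v : ℍ), Φ (a, b) v = (a : ℍ) * v * star (b : ℍ)) ∧
      (∀ p : unitary ℍ × unitary ℍ,
        Φ p = 1 ↔ ((p.1 : ℍ) = 1 ∧ (p.2 : ℍ) = 1) ∨ ((p.1 : ℍ) = -1 ∧ (p.2 : ℍ) = -1)) ∧
      (∀ f : ℍ ≃ₗᵢ[ℝ] ℍ,
        (∃ p, Φ p = f) ↔ LinearMap.det (f.toLinearEquiv : ℍ →ₗ[ℝ] ℍ) = 1) := by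
  refine ⟨unitaryMulMulStarHom, fun a b v => rfl, unitaryMulMulStarHom_eq_one_iff,
    fun f => ⟨?_, fun hf => ?_⟩⟩
  · rintro ⟨p, rfl⟩
    exact det_unitaryMulMulStarHom p
  · rcases linearIsometryEquiv_eq f with ⟨p, hp⟩ | ⟨p, hp⟩
    · exact ⟨p, LinearIsometryEquiv.ext fun x => (hp x).symm⟩
    · have h : (f.toLinearEquiv : ℍ →ₗ[ℝ] ℍ) =
          ((unitaryMulMulStarHom p).toLinearEquiv : ℍ →ₗ[ℝ] ℍ) ∘ₗ
            starLinearMap :=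
        LinearMap.ext hp
      rw [h, LinearMap.det_comp, det_unitaryMulMulStarHom, det_starLinearMap] at hf
      norm_num at hf
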